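/- arXiv:2105.06459 — 2 statements merged into one kernel-verified Lean document; each statement's English description precedes it below -/
import Mathlib

section
/- Let r ≥ 2, N ≥ r − 1, d ≥ N, and let (χ(S_1),…,χ(S_r)) be a fundamental lineup of length r of the fermionic point configuration of N-subsets of [d]. Then: (i) every element of every S_k is at most N + r − 1; (ii) if N > r − 1, then {1,…,N−r+1} ⊆ S_k for all 1 ≤ k ≤ r. -/
noncomputable section

/-- Euclidean inner product on `Fin d → ℝ`. -/
def dotp {d : ℕ} (y x : Fin d → ℝ) : ℝ := ∑ i, y i * x i

/-- Characteristic vector of a subset of `Fin d`. -/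
def chiF {d : ℕ} (S : Finset (Fin d)) : Fin d → ℝ := fun i => if i ∈ S then 1 else 0

/-- `y` is a fundamental vector: its coordinates are weakly decreasing. -/
def Fund {d : ℕ} (y : Fin d → ℝ) : Prop := ∀ i j : Fin d, i ≤ j → y j ≤ y i

/-- `(χ(S 0),…,χ(S (r-1)))` is a fundamental lineup of length `r` of the
fermionic point configuration of `N`-subsets of `[d]`. -/
def IsFundFermionicLineup (d N : ℕ) {r : ℕ} (S : Fin r → Finset (Fin d)) : Prop :=
  Function.Injective S ∧ (∀ k, (S k).card = N) ∧
  ∃ y : Fin d → ℝ, Fund y ∧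
    (∀ k l : Fin r, k < l → dotp y (chiF (S l)) < dotp y (chiF (S k))) ∧
    (∀ T : Finset (Fin d), T.card = N → (∀ k, T ≠ S k) →
      ∀ k, dotp y (chiF T) < dotp y (chiF (S k)))

theorem dotp_chiF_eq {d : ℕ} (y : Fin d → ℝ) (S : Finset (Fin d)) :
    dotp y (chiF S) = ∑ i ∈ S, y i := by
  simp [dotp, chiF]

theorem swap_card {d : ℕ} (S : Finset (Fin d)) (a b : Fin d) (ha : a ∈ S) (hb : b ∉ S) :
    (insert b (S.erase a)).card = S.card := by
  rw [Finset.card_insert_of_notMem (fun h => hb (Finset.mem_of_mem_erase h))]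
  exact Finset.card_erase_add_one ha

theorem swap_dotp {d : ℕ} (y : Fin d → ℝ) (hy : Fund y) (S : Finset (Fin d)) (a b : Fin d)
    (ha : a ∈ S) (hb : b ∉ S) (hab : b ≤ a) :
    dotp y (chiF S) ≤ dotp y (chiF (insert b (S.erase a))) := by
  rw [dotp_chiF_eq, dotp_chiF_eq,
    Finset.sum_insert (fun h => hb (Finset.mem_of_mem_erase h)), ← Finset.add_sum_erase S y ha]
  have := hy b a hab
  linarith

/-- There are fewer than `r` pairs giving distinct improving swaps of `S k`. -/
theorem swap_count {d N r : ℕ} (S : Fin r → Finset (Fin d)) (hS : IsFundFermionicLineup d N S)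
    (k : Fin r) (P : Finset (Fin d)) (f : Fin d → Finset (Fin d))
    (hf : ∀ j ∈ P, ∃ a b, a ∈ S k ∧ b ∉ S k ∧ b ≤ a ∧ f j = insert b ((S k).erase a))
    (hinj : Set.InjOn f P) : P.card < r := by
  obtain ⟨-, hc, y, hy, -, hT⟩ := hS
  have hne : S k ∉ P.image f := by
    intro h
    obtain ⟨j, hj, hjk⟩ := Finset.mem_image.1 h
    obtain ⟨a, b, -, hb, -, he⟩ := hf j hj
    apply hb
    rw [← hjk, he]
    exact Finset.mem_insert_self _ _
  have hsub : insert (S k) (P.image f) ⊆ Finset.univ.image S := by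
    intro T h
    rcases Finset.mem_insert.1 h with rfl | h
    · simp
    · obtain ⟨j, hj, rfl⟩ := Finset.mem_image.1 h
      obtain ⟨a, b, ha, hb, hab, he⟩ := hf j hj
      by_contra hcon
      have h1 := hT (f j) (by rw [he, swap_card _ a b ha hb, hc])
        (fun l hl => hcon (by simp [hl])) k
      have h2 := swap_dotp y hy (S k) a b ha hb hab
      rw [← he] at h2
      linarith
  have h1 := Finset.card_le_card hsub
  have h2 := Finset.card_image_le (s := (Finset.univ : Finset (Fin r))) (f := S)
  rw [Finset.card_insert_of_notMem hne, Finset.card_image_of_injOn hinj] at h1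
  simp at h2
  omega

/-- Stabilization of fermionic lineups.  Elements of `Fin d` are identified with
`{1,…,d}` via `i ↦ (i : ℕ) + 1`.  (i) each element of each `S k` is at most
`N + r - 1`; (ii) if `N > r - 1` then `{1,…,N-r+1} ⊆ S k` for all `k`. -/
theorem lineup_stabilization
    {d N r : ℕ} (hr : 2 ≤ r) (hN : r - 1 ≤ N) (hNd : N ≤ d)
    (S : Fin r → Finset (Fin d)) (hS : IsFundFermionicLineup d N S) :
    (∀ k, ∀ i ∈ S k, (i : ℕ) + 1 ≤ N + r - 1) ∧
    (r - 1 < N → ∀ k, ∀ i : Fin d, (i : ℕ) + 1 ≤ N + 1 - r → i ∈ S k) := by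
  constructor
  · intro k i hi
    have h := swap_count S hS k (Finset.Iio i \ (S k).erase i)
      (fun j => insert j ((S k).erase i))
      (fun j hj => by
        simp only [Finset.mem_sdiff, Finset.mem_Iio, Finset.mem_erase] at hj
        exact ⟨i, j, hi, fun h => hj.2 ⟨hj.1.ne, h⟩, hj.1.le, rfl⟩)
      (fun j hj l hl he => by
        simp only [Finset.coe_sdiff, Set.mem_sdiff, Finset.mem_coe] at hj hl
        beta_reduce at he
        have h1 : j ∈ insert l ((S k).erase i) := by
          rw [← he]; exact Finset.mem_insert_self _ _
        exact (Finset.mem_insert.1 h1).resolve_right hj.2)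
    have h2 := Finset.le_card_sdiff ((S k).erase i) (Finset.Iio i)
    have h3 := Finset.card_erase_add_one hi
    rw [hS.2.1 k] at h3
    rw [Fin.card_Iio] at h2
    omega
  · intro hrN k i hi
    by_contra hik
    have h := swap_count S hS k (S k \ Finset.Iio i)
      (fun j => insert i ((S k).erase j))
      (fun j hj => by
        simp only [Finset.mem_sdiff, Finset.mem_Iio, not_lt] at hj
        exact ⟨j, i, hj.1, hik, hj.2, rfl⟩)
      (fun j hj l hl he => by
        simp only [Finset.coe_sdiff, Set.mem_sdiff, Finset.mem_coe] at hj hl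
        beta_reduce at he
        by_contra hjl
        have h1 : j ∈ insert i ((S k).erase j) := by
          have h0 : j ∈ insert i ((S k).erase l) :=
            Finset.mem_insert_of_mem (Finset.mem_erase.2 ⟨hjl, hj.1⟩)
          rw [he]; exact h0
        rcases Finset.mem_insert.1 h1 with h1 | h1
        · exact hik (h1 ▸ hj.1)
        · simp at h1)
    have h2 := Finset.le_card_sdiff (Finset.Iio i) (S k)
    rw [Fin.card_Iio, hS.2.1 k] at h2
    omega
end
end

section
/- Let N ≥ 3, d ≥ 6 with d − N ≥ 3, and let w = (w_1, w_2, w_3, w_4) satisfy w_1 > w_2 > w_3 > w_4 > 0 and w_1 + w_2 + w_3 + w_4 = 1. Then the fermionic spectral polytope F_4(w,N,d) equals the set of all x ∈ ℝ^d such that Σ_{i=1}^d x_i = N and, denoting by x^↓ the decreasing rearrangement of x: x^↓_1 ≤ 1; Σ_{i=1}^{d−1} x^↓_i ≤ N; Σ_{i=1}^{N} x^↓_i ≤ N − 1 + w_1; 2Σ_{i=1}^{N−1} x^↓_i + x^↓_N + x^↓_{N+1} ≤ 2N − 2 + w_1 + w_2; 2Σ_{i=1}^{N−2} x^↓_i +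 x^↓_{N−1} + x^↓_N + x^↓_{N+1} ≤ 2N − 3 + w_1 + w_2 + w_3; and 2Σ_{i=1}^{N−1} x^↓_i + x^↓_N + x^↓_{N+1} + x^↓_{N+2} ≤ 2N − 2 + w_1 + w_2 + w_3. -/
noncomputable section

/-- The fermionic spectral polytope `F_r(w,N,d)`. -/
def fermiPolytope (d N r : ℕ) (w : Fin r → ℝ) : Set (Fin d → ℝ) :=
  convexHull ℝ {x | ∃ S : Fin r → Finset (Fin d), Function.Injective S ∧
    (∀ k, (S k).card = N) ∧ x = fun i => ∑ k, w k * chiF (S k) i}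

/-- The decreasing rearrangement `x^↓` of a vector `x ∈ ℝ^d`. -/
noncomputable def dsortd {d : ℕ} (x : Fin d → ℝ) : Fin d → ℝ :=
  fun i => x (Tuple.sort (fun j => -x j) i)

/-- Partial sums. -/
def pSum {d : ℕ} (f : Fin d → ℝ) (m : ℕ) : ℝ :=
  ∑ i ∈ Finset.univ.filter fun i : Fin d => (i : ℕ) < m, f i

lemma pSum_succ {d : ℕ} (f : Fin d → ℝ) (m : ℕ) (h : m < d) :
    pSum f (m + 1) = pSum f m + f ⟨m, h⟩ := by
  unfold pSum
  have : (Finset.univ.filter fun i : Fin d => (i : ℕ) < m + 1) =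
      insert ⟨m, h⟩ (Finset.univ.filter fun i : Fin d => (i : ℕ) < m) := by
    ext i
    simp only [Finset.mem_filter, Finset.mem_univ, true_and, Finset.mem_insert, Fin.ext_iff]
    omega
  rw [this, Finset.sum_insert (by simp), add_comm]

lemma pSum_full {d : ℕ} (f : Fin d → ℝ) : pSum f d = ∑ i, f i := by
  unfold pSum
  rw [Finset.filter_true_of_mem]
  intro i _; exact i.2

lemma w_subset_le (w : Fin 4 → ℝ) (hww : StrictAnti w) (hwpos : ∀ k, 0 < w k)
    (K : Finset (Fin 4)) :
    (K.card ≤ 1 → ∑ k ∈ K, w k ≤ w 0) ∧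
    (K.card ≤ 2 → ∑ k ∈ K, w k ≤ w 0 + w 1) ∧
    (K.card ≤ 3 → ∑ k ∈ K, w k ≤ w 0 + w 1 + w 2) := by
  have h0 := hwpos 0
  have h1 := hwpos 1
  have h2 := hwpos 2
  have h3 := hwpos 3
  have h01 : w 1 < w 0 := hww (by decide)
  have h12 : w 2 < w 1 := hww (by decide)
  have h23 : w 3 < w 2 := hww (by decide)
  have e1 : ∑ k ∈ K, w k = ∑ k, if k ∈ K then w k else 0 := by
    rw [Finset.sum_ite_mem, Finset.univ_inter]
  have e2 : K.card = ∑ k, if k ∈ K then 1 else 0 := by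
    simp
  rw [e1, e2]
  simp only [Fin.sum_univ_four]
  by_cases a0 : (0 : Fin 4) ∈ K <;> by_cases a1 : (1 : Fin 4) ∈ K <;>
  by_cases a2 : (2 : Fin 4) ∈ K <;> by_cases a3 : (3 : Fin 4) ∈ K <;>
  simp only [a0, a1, a2, a3, if_true, if_false] <;>
  refine ⟨fun h => ?_, fun h => ?_, fun h => ?_⟩ <;> linarith

lemma card_pre_le {d : ℕ} (T : Finset (Fin d)) (p : ℕ) (hp : p ≤ d) :
    (T.filter fun i : Fin d => (i : ℕ) < p).card ≤ p ∧
    ((T.filter fun i : Fin d => (i : ℕ) < p).card = p → ∀ i : Fin d, (i : ℕ) < p → i ∈ T) := by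
  have hc : (Finset.univ.filter fun i : Fin d => (i : ℕ) < p).card = p := by
    rw [Fin.card_filter_val_lt]; omega
  have hs : (T.filter fun i : Fin d => (i : ℕ) < p) ⊆ Finset.univ.filter fun i : Fin d => (i : ℕ) < p :=
    Finset.filter_subset_filter _ (Finset.subset_univ _)
  refine ⟨(Finset.card_le_card hs).trans hc.le, fun h i hi => ?_⟩
  have := Finset.eq_of_subset_of_card_le hs (by omega)
  have hi' : i ∈ Finset.univ.filter fun i : Fin d => (i : ℕ) < p := by simp [hi]
  rw [← this] at hi'
  exact (Finset.mem_filter.1 hi').1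

lemma sets_bound {d N : ℕ} (p q : ℕ) (hpN : p ≤ N) (hqd : q ≤ d)
    (w : Fin 4 → ℝ) (hwpos : ∀ k, 0 < w k) (hwsum : ∑ k, w k = 1)
    (T : Fin 4 → Finset (Fin d)) (hT : Function.Injective T) (hc : ∀ k, (T k).card = N) :
    ∃ K : Finset (Fin 4), K.card ≤ (q - p).choose (N - p) ∧
      ∑ k, w k * ((((T k).filter fun i : Fin d => (i : ℕ) < p).card : ℝ) +
        (((T k).filter fun i : Fin d => (i : ℕ) < q).card : ℝ)) ≤ (p : ℝ) + N - 1 + ∑ k ∈ K, w k := by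
  classical
  let K : Finset (Fin 4) := Finset.univ.filter fun k =>
    (∀ i : Fin d, (i : ℕ) < p → i ∈ T k) ∧ (∀ i ∈ T k, (i : ℕ) < q)
  refine ⟨K, ?_, ?_⟩
  · let M : Finset (Fin d) := Finset.univ.filter fun i : Fin d => p ≤ (i : ℕ) ∧ (i : ℕ) < q
    have hM : M.card ≤ q - p := by
      have : (M.map Fin.valEmbedding) ⊆ Finset.Ico p q := by
        intro i hi
        simp only [M, Finset.mem_map, Finset.mem_filter, Finset.mem_univ, true_and] at hi
        obtain ⟨a, ha, rfl⟩ := hi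
        simpa using ha
      have := Finset.card_le_card this
      simpa using this
    have h1 : K.card ≤ (M.powersetCard (N - p)).card := by
      apply Finset.card_le_card_of_injOn (fun k => (T k).filter fun i : Fin d => p ≤ (i : ℕ))
      · intro k hk
        simp only [K, Finset.coe_filter, Finset.mem_univ, true_and, Set.mem_ofPred_eq] at hk
        simp only [Finset.mem_coe, Finset.mem_powersetCard]
        constructor
        · intro i hi
          simp only [Finset.mem_filter] at hi
          simp only [M, Finset.mem_filter, Finset.mem_univ, true_and]
          exact ⟨hi.2, hk.2 i hi.1⟩
        · have hA := Finset.card_filter_add_card_filter_not (s := T k) (fun i => (i : ℕ) < p)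
          have hB : ((T k).filter fun i : Fin d => (i : ℕ) < p) =
              Finset.univ.filter fun i : Fin d => (i : ℕ) < p := by
            ext i
            simp only [Finset.mem_filter, Finset.mem_univ, true_and]
            exact ⟨fun h => h.2, fun h => ⟨hk.1 i h, h⟩⟩
          have hNd : N ≤ d := by
            have := Finset.card_le_univ (T k)
            rw [hc, Fintype.card_fin] at this
            exact this
          rw [hB, Fin.card_filter_val_lt, hc] at hA
          simp only [not_lt] at hA
          omega
      · intro k hk l hl hkl
        simp only [K, Finset.coe_filter, Finset.mem_univ, true_and, Set.mem_ofPred_eq] at hk hl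
        apply hT
        ext i
        by_cases hi : (i : ℕ) < p
        · exact ⟨fun _ => hl.1 i hi, fun _ => hk.1 i hi⟩
        · have := Finset.ext_iff.1 hkl i
          simp only [Finset.mem_filter] at this
          have h' : p ≤ (i : ℕ) := by omega
          simpa [h'] using this
    rw [Finset.card_powersetCard] at h1
    exact h1.trans (Nat.choose_le_choose _ hM)
  · have key : ∀ k, w k * ((((T k).filter fun i : Fin d => (i : ℕ) < p).card : ℝ) +
        (((T k).filter fun i : Fin d => (i : ℕ) < q).card : ℝ)) ≤
        w k * ((p : ℝ) + N - 1) + if k ∈ K then w k else 0 := by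
      intro k
      have hNd : N ≤ d := by
        have := Finset.card_le_univ (T k)
        rw [hc, Fintype.card_fin] at this
        exact this
      have h1 := card_pre_le (T k) p (by omega)
      have h2 : ((T k).filter fun i : Fin d => (i : ℕ) < q).card ≤ N := by
        rw [← hc k]; exact Finset.card_filter_le _ _
      have hw := hwpos k
      split_ifs with hk
      · have h3 : (((T k).filter fun i : Fin d => (i : ℕ) < p).card : ℝ) ≤ p := by exact_mod_cast h1.1
        have h4 : (((T k).filter fun i : Fin d => (i : ℕ) < q).card : ℝ) ≤ N := by exact_mod_cast h2
        nlinarith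
      · have h3 : ((T k).filter fun i : Fin d => (i : ℕ) < p).card +
            ((T k).filter fun i : Fin d => (i : ℕ) < q).card + 1 ≤ p + N := by
          by_contra hcon
          apply hk
          simp only [K, Finset.mem_filter, Finset.mem_univ, true_and]
          refine ⟨h1.2 (by omega), ?_⟩
          refine (Finset.card_filter_eq_iff (p := fun i : Fin d => (i : ℕ) < q)).1 ?_
          rw [hc]; omega
        have h4 : (((T k).filter fun i : Fin d => (i : ℕ) < p).card : ℝ) +
            (((T k).filter fun i : Fin d => (i : ℕ) < q).card : ℝ) + 1 ≤ p + N := by exact_mod_cast h3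
        nlinarith
    refine (Finset.sum_le_sum fun k _ => key k).trans ?_
    rw [Finset.sum_add_distrib, ← Finset.sum_mul, hwsum, Finset.sum_ite_mem, Finset.univ_inter]
    linarith

lemma pSum_gen {d : ℕ} (w : Fin 4 → ℝ) (T : Fin 4 → Finset (Fin d)) (m : ℕ) :
    pSum (fun i => ∑ k, w k * chiF (T k) i) m =
      ∑ k, w k * (((T k).filter fun i : Fin d => (i : ℕ) < m).card : ℝ) := by
  unfold pSum
  rw [Finset.sum_comm]
  refine Finset.sum_congr rfl fun k _ => ?_
  rw [← Finset.mul_sum]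
  congr 1
  simp only [chiF]
  rw [Finset.sum_ite, Finset.sum_const_zero, add_zero, Finset.sum_const, nsmul_eq_mul, mul_one]
  congr 2
  ext i; simp [and_comm]

lemma chiF_perm {d : ℕ} (σ : Equiv.Perm (Fin d)) (S : Finset (Fin d)) (i : Fin d) :
    chiF S (σ i) = chiF (S.map σ.symm.toEmbedding) i := by
  simp [chiF, Finset.mem_map_equiv]

/-- A linear inequality valid at all permuted generators holds on the polytope. -/
lemma hull_le {d N : ℕ} {w : Fin 4 → ℝ} (L : (Fin d → ℝ) →ₗ[ℝ] ℝ) (u : ℝ)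
    (h : ∀ T : Fin 4 → Finset (Fin d), Function.Injective T → (∀ k, (T k).card = N) →
      L (fun i => ∑ k, w k * chiF (T k) i) ≤ u) {x : Fin d → ℝ}
    (hx : x ∈ fermiPolytope d N 4 w) (σ : Equiv.Perm (Fin d)) :
    L (fun i => x (σ i)) ≤ u := by
  let L' : (Fin d → ℝ) →ₗ[ℝ] ℝ := L ∘ₗ LinearMap.funLeft ℝ ℝ σ
  have hsub : fermiPolytope d N 4 w ⊆ {x | L' x ≤ u} := by
    apply convexHull_min
    · rintro y ⟨S, hS, hc, rfl⟩
      have := h (fun k => (S k).map σ.symm.toEmbedding)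
        (fun a b hab => hS (Finset.map_injective _ hab)) (by simpa using hc)
      simp only [← chiF_perm] at this
      exact this
    · exact convex_halfSpace_le L'.isLinear u
  exact hsub hx

def pSumL (d m : ℕ) : (Fin d → ℝ) →ₗ[ℝ] ℝ where
  toFun f := pSum f m
  map_add' f g := by simp [pSum, Finset.sum_add_distrib]
  map_smul' c f := by simp [pSum, Finset.mul_sum]

lemma pSumL_apply (d m : ℕ) (f : Fin d → ℝ) : pSumL d m f = pSum f m := rfl

lemma hull_pq {d N : ℕ} (p q : ℕ) (hpN : p ≤ N) (hqd : q ≤ d)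
    (w : Fin 4 → ℝ) (hwpos : ∀ k, 0 < w k) (hwsum : ∑ k, w k = 1) (B : ℝ)
    (hB : ∀ K : Finset (Fin 4), K.card ≤ (q - p).choose (N - p) → ∑ k ∈ K, w k ≤ B)
    {x : Fin d → ℝ} (hx : x ∈ fermiPolytope d N 4 w) :
    pSum (dsortd x) p + pSum (dsortd x) q ≤ (p : ℝ) + N - 1 + B := by
  refine hull_le (pSumL d p + pSumL d q) _ ?_ hx (Tuple.sort (fun j => -x j))
  intro T hT hc
  obtain ⟨K, hK, hle⟩ := sets_bound p q hpN hqd w hwpos hwsum T hT hc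
  have := hB K hK
  simp only [LinearMap.add_apply, pSumL_apply]
  rw [pSum_gen, pSum_gen, ← Finset.sum_add_distrib]
  simp only [← mul_add]
  linarith

lemma hull_p {d N : ℕ} (p : ℕ) (B : ℝ)
    (w : Fin 4 → ℝ) (hwpos : ∀ k, 0 < w k) (hwsum : ∑ k, w k = 1)
    (hB : ∀ T : Finset (Fin d), T.card = N → ((T.filter fun i : Fin d => (i : ℕ) < p).card : ℝ) ≤ B)
    {x : Fin d → ℝ} (hx : x ∈ fermiPolytope d N 4 w) :
    pSum (dsortd x) p ≤ B := by
  refine hull_le (pSumL d p) _ ?_ hx (Tuple.sort (fun j => -x j))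
  intro T hT hc
  simp only [pSumL_apply]
  rw [pSum_gen]
  calc _ ≤ ∑ k, w k * B := Finset.sum_le_sum fun k _ =>
        mul_le_mul_of_nonneg_left (hB _ (hc k)) (hwpos k).le
    _ = B := by rw [← Finset.sum_mul, hwsum, one_mul]

lemma hull_sum {d N : ℕ} (w : Fin 4 → ℝ) (hwsum : ∑ k, w k = 1)
    {x : Fin d → ℝ} (hx : x ∈ fermiPolytope d N 4 w) : ∑ i, x i = N := by
  have hg : ∀ T : Fin 4 → Finset (Fin d), (∀ k, (T k).card = N) →
      pSum (fun i => ∑ k, w k * chiF (T k) i) d = N := by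
    intro T hc
    rw [pSum_gen]
    have : ∀ k, ((T k).filter fun i : Fin d => (i : ℕ) < d) = T k := fun k => by simp
    simp only [this, hc]
    rw [← Finset.sum_mul, hwsum, one_mul]
  have h1 := hull_le (pSumL d d) N (fun T _ hc => (hg T hc).le) hx 1
  have h2 := hull_le (-pSumL d d) (-(N : ℝ))
    (fun T _ hc => by
      have := hg T hc
      simp only [LinearMap.neg_apply, pSumL_apply]
      linarith) hx 1
  simp only [LinearMap.neg_apply, pSumL_apply, pSum_full,
    Equiv.Perm.one_apply] at h1 h2
  linarith

/-- The central finite inequality, in four cases. -/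
lemma core_ineq (w0 w1 w2 w3 c0 c1 c2 c3 c4 c5 z0 z1 z2 z3 z4 z5 s t : ℝ)
    (hw : w0 + w1 + w2 + w3 = 1) (hw3 : 0 < w3)
    (h0 : c1 ≤ c0) (h1 : c2 ≤ c1) (h2 : c3 ≤ c2) (h3 : c4 ≤ c3) (h4 : c5 ≤ c4)
    (hsum : s + z0 + z1 + z2 + z3 + z4 + z5 + t = 3)
    (hy0 : s + z0 ≤ 1) (hy4 : 0 ≤ z5 + t)
    (hN : s + z0 + z1 + z2 ≤ 2 + w0)
    (hA : (s + z0 + z1) + (s + z0 + z1 + z2 + z3) ≤ 4 + w0 + w1)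
    (hB : (s + z0) + (s + z0 + z1 + z2 + z3) ≤ 3 + w0 + w1 + w2)
    (hC : (s + z0 + z1) + (s + z0 + z1 + z2 + z3 + z4) ≤ 4 + w0 + w1 + w2)
    (hy1 : s + z0 + z1 ≤ 2) (hy3 : s + z0 + z1 + z2 + z3 ≤ 3) (V : ℝ)
    (V1 : w0 * (c0 + c1 + c2) + w1 * (c0 + c1 + c3) + w2 * (c0 + c2 + c3)
      + w3 * (c0 + c1 + c4) ≤ V)
    (V2 : w0 * (c0 + c1 + c2) + w1 * (c0 + c1 + c3) + w2 * (c0 + c2 + c3)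
      + w3 * (c1 + c2 + c3) ≤ V)
    (V3 : w0 * (c0 + c1 + c2) + w1 * (c0 + c1 + c3) + w2 * (c0 + c1 + c4)
      + w3 * (c0 + c2 + c3) ≤ V)
    (V4 : w0 * (c0 + c1 + c2) + w1 * (c0 + c1 + c3) + w2 * (c0 + c1 + c4)
      + w3 * (c0 + c1 + c5) ≤ V) :
    c0 * s + c0 * z0 + c1 * z1 + c2 * z2 + c3 * z3 + c4 * z4 + c5 * z5 + c5 * t ≤ V := by
  obtain rfl : w0 = 1 - w1 - w2 - w3 := by linarith
  obtain rfl : t = 3 - (s + z0 + z1 + z2 + z3 + z4 + z5) := by linarith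
  have a := mul_le_mul_of_nonneg_left hN (sub_nonneg.2 h2)
  rcases le_total (c1 - c2) (c3 - c4) with hbe | hbe
  · have b := mul_le_mul_of_nonneg_left hA (sub_nonneg.2 h1)
    have e' := mul_nonneg (sub_nonneg.2 h4) hy4
    rcases le_total (c3 - c4 - (c1 - c2)) (c0 - c1) with h | h
    · have g := mul_le_mul_of_nonneg_left hB (sub_nonneg.2 hbe)
      have g' := mul_le_mul_of_nonneg_left hy0 (sub_nonneg.2 h)
      linarith
    · have g := mul_le_mul_of_nonneg_left hB (sub_nonneg.2 h0)
      have g' := mul_le_mul_of_nonneg_left hy3 (sub_nonneg.2 h)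
      linarith
  · have b := mul_le_mul_of_nonneg_left hA (sub_nonneg.2 h3)
    have e' := mul_le_mul_of_nonneg_left hy0 (sub_nonneg.2 h0)
    rcases le_total (c1 - c2 - (c3 - c4)) (c4 - c5) with h | h
    · have g := mul_le_mul_of_nonneg_left hC (sub_nonneg.2 hbe)
      have g' := mul_nonneg (sub_nonneg.2 h) hy4
      linarith
    · have g := mul_le_mul_of_nonneg_left hC (sub_nonneg.2 h4)
      have g' := mul_le_mul_of_nonneg_left hy1 (sub_nonneg.2 h)
      linarith

/-- The window embedding. -/
def winE {n d : ℕ} (h : n + 6 ≤ d) : Fin 6 ↪ Fin d where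
  toFun j := ⟨n + j, by omega⟩
  inj' a b hab := by
    simp only [Fin.mk.injEq] at hab
    ext; omega

lemma winE_val {n d : ℕ} (h : n + 6 ≤ d) (j : Fin 6) : (winE h j : ℕ) = n + j := rfl

/-- Initial segment together with a pattern in the window. -/
def winS {n d : ℕ} (h : n + 6 ≤ d) (A : Finset (Fin 6)) : Finset (Fin d) :=
  (Finset.univ.filter fun i : Fin d => (i : ℕ) < n) ∪ A.map (winE h)

lemma winS_disj {n d : ℕ} (h : n + 6 ≤ d) (A : Finset (Fin 6)) :
    Disjoint (Finset.univ.filter fun i : Fin d => (i : ℕ) < n) (A.map (winE h)) := by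
  rw [Finset.disjoint_left]
  intro i hi hi'
  simp only [Finset.mem_filter, Finset.mem_univ, true_and] at hi
  obtain ⟨j, _, rfl⟩ := Finset.mem_map.1 hi'
  rw [winE_val] at hi
  omega

lemma winS_card {n d : ℕ} (h : n + 6 ≤ d) (A : Finset (Fin 6)) :
    (winS h A).card = n + A.card := by
  rw [winS, Finset.card_union_of_disjoint (winS_disj h A), Finset.card_map,
    Fin.card_filter_val_lt]
  congr 1
  omega

lemma winS_inj {n d : ℕ} (h : n + 6 ≤ d) : Function.Injective (winS h) := by
  intro A B hAB
  ext j
  have h1 : ∀ A : Finset (Fin 6), winE h j ∈ winS h A ↔ j ∈ A := by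
    intro A
    simp only [winS, Finset.mem_union, Finset.mem_filter, Finset.mem_univ, true_and,
      Finset.mem_map' (winE h)]
    simp [winE_val]
  rw [← h1 A, ← h1 B, hAB]

lemma winS_sum {n d : ℕ} (h : n + 6 ≤ d) (A : Finset (Fin 6)) (C : Fin d → ℝ) :
    ∑ i, C i * chiF (winS h A) i = pSum C n + ∑ j ∈ A, C (winE h j) := by
  simp only [chiF, mul_ite, mul_one, mul_zero]
  rw [Finset.sum_ite_mem, Finset.univ_inter, winS, Finset.sum_union (winS_disj h A),
    Finset.sum_map]
  rfl

lemma win_value {n d : ℕ} (h : n + 6 ≤ d) (w : Fin 4 → ℝ) (hwsum : ∑ k, w k = 1)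
    (C : Fin d → ℝ) (u : ℝ)
    (hu : ∀ T : Fin 4 → Finset (Fin d), Function.Injective T → (∀ k, (T k).card = n + 3) →
      ∑ i, C i * (∑ k, w k * chiF (T k) i) ≤ u)
    (A : Fin 4 → Finset (Fin 6)) (hA : Function.Injective A) (hc : ∀ k, (A k).card = 3) :
    ∑ k, w k * ∑ j ∈ A k, C (winE h j) ≤ u - pSum C n := by
  have := hu (fun k => winS h (A k)) (fun a b hab => hA (winS_inj h hab))
    (fun k => by rw [winS_card, hc])
  have e : ∑ i, C i * (∑ k, w k * chiF (winS h (A k)) i) =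
      ∑ k, w k * (pSum C n + ∑ j ∈ A k, C (winE h j)) := by
    simp only [← winS_sum, Finset.mul_sum]
    rw [Finset.sum_comm]
    refine Finset.sum_congr rfl fun k _ => Finset.sum_congr rfl fun i _ => by ring
  rw [e] at this
  simp only [mul_add, Finset.sum_add_distrib, ← Finset.sum_mul, hwsum, one_mul] at this
  linarith

lemma sorted_bound {n d : ℕ} (h : n + 6 ≤ d) (w : Fin 4 → ℝ) (hwpos : ∀ k, 0 < w k)
    (hwsum : ∑ k, w k = 1) (C Y : Fin d → ℝ) (hC : Antitone C)
    (u : ℝ)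
    (hu : ∀ T : Fin 4 → Finset (Fin d), Function.Injective T → (∀ k, (T k).card = n + 3) →
      ∑ i, C i * (∑ k, w k * chiF (T k) i) ≤ u)
    (hY1 : ∀ i, Y i ≤ 1) (hY0 : ∀ i, 0 ≤ Y i) (hsum : ∑ i, Y i = (n : ℝ) + 3)
    (k1 : pSum Y (n + 3) ≤ (n : ℝ) + 2 + w 0)
    (k2 : pSum Y (n + 2) + pSum Y (n + 4) ≤ 2 * (n : ℝ) + 4 + w 0 + w 1)
    (k3 : pSum Y (n + 1) + pSum Y (n + 4) ≤ 2 * (n : ℝ) + 3 + w 0 + w 1 + w 2)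
    (k4 : pSum Y (n + 2) + pSum Y (n + 5) ≤ 2 * (n : ℝ) + 4 + w 0 + w 1 + w 2) :
    ∑ i, C i * Y i ≤ u := by
  have six : ∀ f : Fin d → ℝ, pSum f (n + 6) = pSum f n + f (winE h 0) + f (winE h 1)
      + f (winE h 2) + f (winE h 3) + f (winE h 4) + f (winE h 5) := by
    intro f
    rw [pSum_succ f (n + 5) (by omega), pSum_succ f (n + 4) (by omega),
      pSum_succ f (n + 3) (by omega), pSum_succ f (n + 2) (by omega),
      pSum_succ f (n + 1) (by omega), pSum_succ f n (by omega)]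
    rfl
  have p1 : pSum Y (n + 1) = pSum Y n + Y (winE h 0) := pSum_succ Y n (by omega)
  have p2 : pSum Y (n + 2) = pSum Y (n + 1) + Y (winE h 1) := pSum_succ Y (n + 1) (by omega)
  have p3 : pSum Y (n + 3) = pSum Y (n + 2) + Y (winE h 2) := pSum_succ Y (n + 2) (by omega)
  have p4 : pSum Y (n + 4) = pSum Y (n + 3) + Y (winE h 3) := pSum_succ Y (n + 3) (by omega)
  have p5 : pSum Y (n + 5) = pSum Y (n + 4) + Y (winE h 4) := pSum_succ Y (n + 4) (by omega)
  have split : ∀ f : Fin d → ℝ, ∑ i, f i = pSum f (n + 6) +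
      ∑ i ∈ Finset.univ.filter fun i : Fin d => ¬ (i : ℕ) < n + 6, f i := fun f =>
    (Finset.sum_filter_add_sum_filter_not _ _ _).symm
  set t := ∑ i ∈ Finset.univ.filter fun i : Fin d => ¬ (i : ℕ) < n + 6, Y i with ht
  have ht0 : 0 ≤ t := Finset.sum_nonneg fun i _ => hY0 i
  have hcard : (∑ i ∈ Finset.univ.filter fun i : Fin d => (i : ℕ) < n, (1 : ℝ)) = n := by
    rw [Finset.sum_const, Fin.card_filter_val_lt, nsmul_eq_mul, mul_one]
    congr 1; omega
  have hs : pSum Y n ≤ n := by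
    rw [← hcard]; exact Finset.sum_le_sum fun i _ => hY1 i
  have hP : pSum (fun i => C i * Y i) n ≤ pSum C n + C (winE h 0) * (pSum Y n - n) := by
    rw [← hcard]
    unfold pSum
    rw [← Finset.sum_sub_distrib, Finset.mul_sum, ← Finset.sum_add_distrib]
    refine Finset.sum_le_sum fun i hi => ?_
    simp only [Finset.mem_filter, Finset.mem_univ, true_and] at hi
    have h1 : C (winE h 0) ≤ C i := hC (by rw [Fin.le_def]; rw [winE_val]; simp; omega)
    nlinarith [hY1 i]
  have hQ : (∑ i ∈ Finset.univ.filter fun i : Fin d => ¬ (i : ℕ) < n + 6, C i * Y i)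
      ≤ C (winE h 5) * t := by
    rw [ht, Finset.mul_sum]
    refine Finset.sum_le_sum fun i hi => ?_
    simp only [Finset.mem_filter, Finset.mem_univ, true_and] at hi
    have h1 : C i ≤ C (winE h 5) := hC (by rw [Fin.le_def]; rw [winE_val]; simp; omega)
    exact mul_le_mul_of_nonneg_right h1 (hY0 i)
  have mono : ∀ a b : Fin 6, a ≤ b → C (winE h b) ≤ C (winE h a) := by
    intro a b hab
    apply hC
    rw [Fin.le_def] at *
    simpa [winE_val] using hab
  have V1 := win_value h w hwsum C u hu ![{0,1,2},{0,1,3},{0,2,3},{0,1,4}] (by decide) (by decide)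
  have V2 := win_value h w hwsum C u hu ![{0,1,2},{0,1,3},{0,2,3},{1,2,3}] (by decide) (by decide)
  have V3 := win_value h w hwsum C u hu ![{0,1,2},{0,1,3},{0,1,4},{0,2,3}] (by decide) (by decide)
  have V4 := win_value h w hwsum C u hu ![{0,1,2},{0,1,3},{0,1,4},{0,1,5}] (by decide) (by decide)
  have tri : ∀ (a b c : Fin 6) (f : Fin 6 → ℝ), a ≠ b → a ≠ c → b ≠ c →
      ∑ j ∈ ({a, b, c} : Finset (Fin 6)), f j = f a + f b + f c := by
    intro a b c f hab hac hbc
    rw [Finset.sum_insert (by simp [hab, hac]), Finset.sum_pair hbc, add_assoc]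
  rw [Fin.sum_univ_four] at V1 V2 V3 V4 hwsum
  simp only [Matrix.cons_val] at V1 V2 V3 V4
  rw [tri _ _ _ _ (by decide) (by decide) (by decide),
    tri _ _ _ _ (by decide) (by decide) (by decide),
    tri _ _ _ _ (by decide) (by decide) (by decide),
    tri _ _ _ _ (by decide) (by decide) (by decide)] at V1 V2 V3 V4
  have hsum' := hsum
  rw [split, six] at hsum'
  have := core_ineq (w 0) (w 1) (w 2) (w 3) (C (winE h 0)) (C (winE h 1)) (C (winE h 2))
    (C (winE h 3)) (C (winE h 4)) (C (winE h 5)) (Y (winE h 0)) (Y (winE h 1)) (Y (winE h 2))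
    (Y (winE h 3)) (Y (winE h 4)) (Y (winE h 5)) (pSum Y n - n) t hwsum (hwpos 3)
    (mono _ _ (by decide)) (mono _ _ (by decide)) (mono _ _ (by decide)) (mono _ _ (by decide))
    (mono _ _ (by decide)) (by linarith) (by linarith [hY1 (winE h 0)])
    (by linarith [hY0 (winE h 5)]) (by linarith) (by linarith) (by linarith) (by linarith)
    (by linarith [hY1 (winE h 0), hY1 (winE h 1)])
    (by linarith [hY0 (winE h 5), hY0 (winE h 4)]) _ V1 V2 V3 V4
  rw [split, six]
  linarith

lemma dsortd_antitone {d : ℕ} (x : Fin d → ℝ) : Antitone (dsortd x) := by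
  intro i j hij
  have := Tuple.monotone_sort (fun j => -x j) hij
  simp only [Function.comp] at this
  exact neg_le_neg_iff.1 this

lemma dsortd_sum {d : ℕ} (x : Fin d → ℝ) : ∑ i, dsortd x i = ∑ i, x i :=
  Equiv.sum_comp (Tuple.sort (fun j => -x j)) x

lemma mem_of_ineqs {n d : ℕ} (h : n + 6 ≤ d) (w : Fin 4 → ℝ) (hwpos : ∀ k, 0 < w k)
    (hwsum : ∑ k, w k = 1) (x : Fin d → ℝ)
    (hY1 : ∀ i, dsortd x i ≤ 1) (hY0 : ∀ i, 0 ≤ dsortd x i) (hsum : ∑ i, x i = (n : ℝ) + 3)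
    (k1 : pSum (dsortd x) (n + 3) ≤ (n : ℝ) + 2 + w 0)
    (k2 : pSum (dsortd x) (n + 2) + pSum (dsortd x) (n + 4) ≤ 2 * (n : ℝ) + 4 + w 0 + w 1)
    (k3 : pSum (dsortd x) (n + 1) + pSum (dsortd x) (n + 4) ≤
      2 * (n : ℝ) + 3 + w 0 + w 1 + w 2)
    (k4 : pSum (dsortd x) (n + 2) + pSum (dsortd x) (n + 5) ≤
      2 * (n : ℝ) + 4 + w 0 + w 1 + w 2) :
    x ∈ fermiPolytope d (n + 3) 4 w := by
  by_contra hx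
  have hfin : {x : Fin d → ℝ | ∃ S : Fin 4 → Finset (Fin d), Function.Injective S ∧
    (∀ k, (S k).card = n + 3) ∧ x = fun i => ∑ k, w k * chiF (S k) i}.Finite := by
    refine (Set.finite_range
      (fun S : Fin 4 → Finset (Fin d) => fun i => ∑ k, w k * chiF (S k) i)).subset ?_
    rintro y ⟨S, _, _, rfl⟩
    exact ⟨S, rfl⟩
  obtain ⟨f, u, hf, hfx⟩ := geometric_hahn_banach_closed_point (convex_convexHull ℝ _)
    (hfin.isClosed_convexHull ℝ) hx
  let c : Fin d → ℝ := fun i => f (Pi.single i 1)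
  have hfc : ∀ y : Fin d → ℝ, f y = ∑ i, c i * y i := by
    intro y
    conv_lhs => rw [pi_eq_sum_univ' y]
    rw [map_sum]
    refine Finset.sum_congr rfl fun i _ => ?_
    rw [map_smul, smul_eq_mul, mul_comm]
  let τ := Tuple.sort (fun j => -c j)
  let σ := Tuple.sort (fun j => -x j)
  have hCanti : Antitone (dsortd c) := dsortd_antitone c
  have main := sorted_bound h w hwpos hwsum (dsortd c) (dsortd x) hCanti u ?_ hY1 hY0
    ((dsortd_sum x).trans hsum) k1 k2 k3 k4
  · have e : ∑ i, c i * x i = ∑ i, dsortd c i * dsortd x ((τ.trans σ.symm) i) := by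
      rw [← Equiv.sum_comp τ]
      refine Finset.sum_congr rfl fun i _ => ?_
      simp [dsortd, τ, σ]
    have mv : Monovary (dsortd c) (dsortd x) :=
      hCanti.monovary (dsortd_antitone x)
    have := mv.sum_mul_comp_perm_le_sum_mul (σ := τ.trans σ.symm)
    rw [hfc, e] at hfx
    linarith
  · intro T hT hc
    have hmem : (fun i => ∑ k, w k * chiF ((T k).map τ.toEmbedding) i) ∈
        fermiPolytope d (n + 3) 4 w :=
      subset_convexHull ℝ _ ⟨fun k => (T k).map τ.toEmbedding,
        fun a b hab => hT (Finset.map_injective _ hab), by simpa using hc, rfl⟩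
    have := hf _ hmem
    rw [hfc, ← Equiv.sum_comp τ] at this
    refine le_of_eq_of_le ?_ this.le
    refine Finset.sum_congr rfl fun i _ => ?_
    simp [dsortd, τ, chiF]

/-- Non-redundant `H`-representation of the fermionic spectral polytope for
`r = 4` (Theorem for `r = 4`, generalized exclusion principles). -/
theorem fermiPolytope_r4_H_representation
    {N d : ℕ} (hN : 3 ≤ N) (hd6 : 6 ≤ d) (hdN : 3 ≤ d - N)
    (w : Fin 4 → ℝ) (hww : StrictAnti w) (hwpos : ∀ k, 0 < w k)
    (hwsum : ∑ k, w k = 1) :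
    fermiPolytope d N 4 w =
      {x : Fin d → ℝ |
        (∑ i, x i) = (N : ℝ) ∧
        dsortd x ⟨0, by omega⟩ ≤ 1 ∧
        (∑ i ∈ Finset.univ.filter fun i : Fin d => (i : ℕ) < d - 1, dsortd x i)
          ≤ (N : ℝ) ∧
        (∑ i ∈ Finset.univ.filter fun i : Fin d => (i : ℕ) < N, dsortd x i)
          ≤ (N : ℝ) - 1 + w 0 ∧
        2 * (∑ i ∈ Finset.univ.filter fun i : Fin d => (i : ℕ) < N - 1, dsortd x i)
            + dsortd x ⟨N - 1, by omega⟩ + dsortd x ⟨N, by omega⟩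
          ≤ 2 * (N : ℝ) - 2 + w 0 + w 1 ∧
        2 * (∑ i ∈ Finset.univ.filter fun i : Fin d => (i : ℕ) < N - 2, dsortd x i)
            + dsortd x ⟨N - 2, by omega⟩ + dsortd x ⟨N - 1, by omega⟩
            + dsortd x ⟨N, by omega⟩
          ≤ 2 * (N : ℝ) - 3 + w 0 + w 1 + w 2 ∧
        2 * (∑ i ∈ Finset.univ.filter fun i : Fin d => (i : ℕ) < N - 1, dsortd x i)
            + dsortd x ⟨N - 1, by omega⟩ + dsortd x ⟨N, by omega⟩
            + dsortd x ⟨N + 1, by omega⟩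
          ≤ 2 * (N : ℝ) - 2 + w 0 + w 1 + w 2} := by
  obtain ⟨n, rfl⟩ : ∃ n, N = n + 3 := ⟨N - 3, by omega⟩
  have h6 : n + 6 ≤ d := by omega
  ext x
  set Y := dsortd x with hY
  have hYs : pSum Y d = ∑ i, x i := (pSum_full Y).trans (dsortd_sum x)
  have q0 : pSum Y 0 = 0 := by simp [pSum]
  have q1 : pSum Y 1 = pSum Y 0 + Y ⟨0, by omega⟩ := pSum_succ Y 0 (by omega)
  have qd : pSum Y d = pSum Y (d - 1) + Y ⟨d - 1, by omega⟩ := by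
    rw [← pSum_succ Y (d - 1) (by omega)]
    congr 1; omega
  have p2 : pSum Y (n + 2) = pSum Y (n + 1) + Y ⟨n + 1, by omega⟩ := pSum_succ Y _ _
  have p3 : pSum Y (n + 3) = pSum Y (n + 2) + Y ⟨n + 2, by omega⟩ := pSum_succ Y _ _
  have p4 : pSum Y (n + 4) = pSum Y (n + 3) + Y ⟨n + 3, by omega⟩ := pSum_succ Y _ _
  have p5 : pSum Y (n + 5) = pSum Y (n + 4) + Y ⟨n + 4, by omega⟩ := pSum_succ Y _ _
  change _ ↔ (∑ i, x i) = ((n + 3 : ℕ) : ℝ) ∧ Y ⟨0, by omega⟩ ≤ 1 ∧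
    pSum Y (d - 1) ≤ ((n + 3 : ℕ) : ℝ) ∧
    pSum Y (n + 3) ≤ ((n + 3 : ℕ) : ℝ) - 1 + w 0 ∧
    2 * pSum Y (n + 2) + Y ⟨n + 2, by omega⟩ + Y ⟨n + 3, by omega⟩ ≤
      2 * ((n + 3 : ℕ) : ℝ) - 2 + w 0 + w 1 ∧
    2 * pSum Y (n + 1) + Y ⟨n + 1, by omega⟩ + Y ⟨n + 2, by omega⟩ + Y ⟨n + 3, by omega⟩ ≤
      2 * ((n + 3 : ℕ) : ℝ) - 3 + w 0 + w 1 + w 2 ∧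
    2 * pSum Y (n + 2) + Y ⟨n + 2, by omega⟩ + Y ⟨n + 3, by omega⟩ + Y ⟨n + 4, by omega⟩ ≤
      2 * ((n + 3 : ℕ) : ℝ) - 2 + w 0 + w 1 + w 2
  push_cast
  constructor
  · intro hx
    have hs : ∑ i, x i = (n : ℝ) + 3 := by
      have := hull_sum w hwsum hx
      push_cast at this
      exact this
    have W := w_subset_le w hww hwpos
    have b0 : pSum Y 1 ≤ 1 := hull_p 1 1 w hwpos hwsum (fun T _ => by
      exact_mod_cast (card_pre_le T 1 (by omega)).1) hx
    have bd : pSum Y (d - 1) ≤ (n : ℝ) + 3 := hull_p (d - 1) _ w hwpos hwsum (fun T hT => by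
      have h : (T.filter fun i : Fin d => (i : ℕ) < d - 1).card ≤ n + 3 := by
        rw [← hT]; exact Finset.card_filter_le _ _
      exact_mod_cast h) hx
    have b1 := hull_pq (n + 3) d le_rfl le_rfl w hwpos hwsum (w 0)
      (fun K hK => (W K).1 (by simpa using hK)) hx
    have b2 := hull_pq (n + 2) (n + 4) (by omega) (by omega) w hwpos hwsum (w 0 + w 1)
      (fun K hK => (W K).2.1 (by
        rw [show n + 4 - (n + 2) = 2 by omega, show n + 3 - (n + 2) = 1 by omega] at hK
        exact hK)) hx
    have b3 := hull_pq (n + 1) (n + 4) (by omega) (by omega) w hwpos hwsum (w 0 + w 1 + w 2)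
      (fun K hK => (W K).2.2 (by
        rw [show n + 4 - (n + 1) = 3 by omega, show n + 3 - (n + 1) = 2 by omega] at hK
        exact hK)) hx
    have b4 := hull_pq (n + 2) (n + 5) (by omega) (by omega) w hwpos hwsum (w 0 + w 1 + w 2)
      (fun K hK => (W K).2.2 (by
        rw [show n + 5 - (n + 2) = 3 by omega, show n + 3 - (n + 2) = 1 by omega] at hK
        exact hK)) hx
    push_cast at b1 b2 b3 b4
    simp only [← hY] at b1 b2 b3 b4
    refine ⟨hs, ?_, bd, ?_, ?_, ?_, ?_⟩ <;> linarith
  · rintro ⟨hs, b0, bd, b1, b2, b3, b4⟩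
    have hanti : Antitone Y := dsortd_antitone x
    refine mem_of_ineqs h6 w hwpos hwsum x (fun i => ?_) (fun i => ?_) hs ?_ ?_ ?_ ?_
    · exact (hanti (Fin.le_def.2 (Nat.zero_le _))).trans b0
    · have h1 : Y ⟨d - 1, by omega⟩ ≤ Y i := hanti (Fin.le_def.2 (by have := i.2; simp; omega))
      change 0 ≤ Y i
      linarith
    all_goals (simp only [← hY]; linarith)
end
end
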